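/- Let V be an oriented 4-dimensional real vector space with inner product h and Hodge star *_h on Λ²V, and let R̂_h : Λ²V → Λ²V be a ⟨·,·⟩_h-self-adjoint operator satisfying the first Bianchi identity with respect to ⟨·,·⟩_h. Then R̂_h commutes with *_h if and only if ⟨R̂_h(*_h P), *_h P⟩_h = ⟨R̂_h P, P⟩_h for all decomposable unit bivectors P. -/

import Mathlib

open scoped RealInnerProductSpace
open ExteriorAlgebra

namespace HodgeAux

variable {V : Type*} [NormedAddCommGroup V] [InnerProductSpace ℝ V]

/-- The bivector with the given six coordinates with respect to an orthonormal basis. -/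
noncomputable def biv (e : OrthonormalBasis (Fin 4) ℝ V) (a b c d f g : ℝ) :
    ExteriorAlgebra ℝ V :=
  a • (ι ℝ (e 0) * ι ℝ (e 1)) + b • (ι ℝ (e 0) * ι ℝ (e 2)) + c • (ι ℝ (e 0) * ι ℝ (e 3))
    + d • (ι ℝ (e 1) * ι ℝ (e 2)) + f • (ι ℝ (e 1) * ι ℝ (e 3)) + g • (ι ℝ (e 2) * ι ℝ (e 3))

lemma swap (v w : V) : ι ℝ v * ι ℝ w = - (ι ℝ w * ι ℝ v) :=
  eq_neg_of_add_eq_zero_left (ι_add_mul_swap v w)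

lemma mul_mem (v w : V) : ι ℝ v * ι ℝ w ∈ ⋀[ℝ]^2 V := by
  rw [exteriorPower, pow_two]
  exact Submodule.mul_mem_mul ⟨v, rfl⟩ ⟨w, rfl⟩

lemma biv_mem (e : OrthonormalBasis (Fin 4) ℝ V) (a b c d f g : ℝ) :
    biv e a b c d f g ∈ ⋀[ℝ]^2 V := by
  unfold biv
  refine add_mem (add_mem (add_mem (add_mem (add_mem ?_ ?_) ?_) ?_) ?_) ?_ <;>
    exact Submodule.smul_mem _ _ (mul_mem _ _)

lemma mul_eq_biv (e : OrthonormalBasis (Fin 4) ℝ V) (x0 x1 x2 x3 y0 y1 y2 y3 : ℝ) :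
    ι ℝ (x0 • e 0 + x1 • e 1 + x2 • e 2 + x3 • e 3) *
      ι ℝ (y0 • e 0 + y1 • e 1 + y2 • e 2 + y3 • e 3) =
    biv e (x0 * y1 - x1 * y0) (x0 * y2 - x2 * y0) (x0 * y3 - x3 * y0)
      (x1 * y2 - x2 * y1) (x1 * y3 - x3 * y1) (x2 * y3 - x3 * y2) := by
  simp only [map_add, map_smul, mul_add, add_mul, smul_mul_assoc, mul_smul_comm, ι_sq_zero,
    smul_zero, biv]
  rw [swap (e 1) (e 0), swap (e 2) (e 0), swap (e 3) (e 0), swap (e 2) (e 1), swap (e 3) (e 1),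
    swap (e 3) (e 2)]
  module

lemma exists_biv (e : OrthonormalBasis (Fin 4) ℝ V) {ξ : ExteriorAlgebra ℝ V}
    (h : ξ ∈ ⋀[ℝ]^2 V) : ∃ a b c d f g, ξ = biv e a b c d f g := by
  rw [exteriorPower, pow_two] at h
  induction h using Submodule.mul_induction_on' with
  | mem_mul_mem m hm n hn =>
    obtain ⟨v, rfl⟩ := hm
    obtain ⟨w, rfl⟩ := hn
    rw [← e.sum_repr v, ← e.sum_repr w, Fin.sum_univ_four, Fin.sum_univ_four, mul_eq_biv]
    exact ⟨_, _, _, _, _, _, rfl⟩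
  | add x hx y hy h1 h2 =>
    obtain ⟨a, b, c, d, f, g, rfl⟩ := h1
    obtain ⟨a2, b2, c2, d2, f2, g2, rfl⟩ := h2
    refine ⟨a + a2, b + b2, c + c2, d + d2, f + f2, g + g2, ?_⟩
    unfold biv
    module

lemma sw3 (v w : V) (z : ExteriorAlgebra ℝ V) :
    ι ℝ v * (ι ℝ w * z) = - (ι ℝ w * (ι ℝ v * z)) := by
  rw [← mul_assoc, swap, neg_mul, mul_assoc]

lemma sq3 (v : V) (z : ExteriorAlgebra ℝ V) : ι ℝ v * (ι ℝ v * z) = 0 := by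
  rw [← mul_assoc, ι_sq_zero, zero_mul]

lemma biv_mul (e : OrthonormalBasis (Fin 4) ℝ V) (a b c d f g a2 b2 c2 d2 f2 g2 : ℝ) :
    biv e a b c d f g * biv e a2 b2 c2 d2 f2 g2 =
      (a * g2 - b * f2 + c * d2 + d * c2 - f * b2 + g * a2) •
        (ι ℝ (e 0) * ι ℝ (e 1) * ι ℝ (e 2) * ι ℝ (e 3)) := by
  simp only [biv, mul_add, add_mul, smul_mul_assoc, mul_smul_comm, mul_assoc]
  simp only [sw3 (e 1) (e 0), sw3 (e 2) (e 0), sw3 (e 3) (e 0), sw3 (e 2) (e 1), sw3 (e 3) (e 1),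
    sw3 (e 3) (e 2), swap (e 2) (e 1),
    swap (e 3) (e 1), swap (e 3) (e 2), sq3, ι_sq_zero, mul_neg, neg_neg, mul_zero, smul_zero,
    neg_zero, smul_neg]
  module

lemma dV_ne (e : OrthonormalBasis (Fin 4) ℝ V) :
    ι ℝ (e 0) * ι ℝ (e 1) * ι ℝ (e 2) * ι ℝ (e 3) ≠ 0 := by
  intro h
  have h1 : ιMulti ℝ 4 e = 0 := by
    rw [ιMulti_apply]
    simpa [List.ofFn_succ, mul_assoc, Fin.succ] using h
  have h2 := liftAlternating_apply_ιMulti (R := ℝ)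
    (Function.update (fun _ => 0) 4 e.toBasis.det : ∀ i, V [⋀^Fin i]→ₗ[ℝ] ℝ) e
  rw [h1, map_zero, Function.update_self] at h2
  have h3 := e.toBasis.det_self
  rw [e.coe_toBasis, ← h2] at h3
  exact zero_ne_one h3

lemma Bh_biv (e : OrthonormalBasis (Fin 4) ℝ V)
    (Bh : ExteriorAlgebra ℝ V →ₗ[ℝ] ExteriorAlgebra ℝ V →ₗ[ℝ] ℝ)
    (hBh : ∀ v w x y : V,
      Bh (ι ℝ v * ι ℝ w) (ι ℝ x * ι ℝ y) = ⟪v, x⟫ * ⟪w, y⟫ - ⟪v, y⟫ * ⟪w, x⟫)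
    (a b c d f g a2 b2 c2 d2 f2 g2 : ℝ) :
    Bh (biv e a b c d f g) (biv e a2 b2 c2 d2 f2 g2) =
      a * a2 + b * b2 + c * c2 + d * d2 + f * f2 + g * g2 := by
  have ho := orthonormal_iff_ite.mp e.orthonormal
  simp only [biv, map_add, map_smul, LinearMap.add_apply, LinearMap.smul_apply, hBh, ho,
    smul_eq_mul]
  simp
  ring

lemma star_biv (e : OrthonormalBasis (Fin 4) ℝ V)
    (Bh : ExteriorAlgebra ℝ V →ₗ[ℝ] ExteriorAlgebra ℝ V →ₗ[ℝ] ℝ)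
    (hBh : ∀ v w x y : V,
      Bh (ι ℝ v * ι ℝ w) (ι ℝ x * ι ℝ y) = ⟪v, x⟫ * ⟪w, y⟫ - ⟪v, y⟫ * ⟪w, x⟫)
    (dV : ExteriorAlgebra ℝ V)
    (hdV : dV = ι ℝ (e 0) * ι ℝ (e 1) * ι ℝ (e 2) * ι ℝ (e 3))
    (star : ExteriorAlgebra ℝ V →ₗ[ℝ] ExteriorAlgebra ℝ V)
    (hstar_mem : ∀ ξ ∈ ⋀[ℝ]^2 V, star ξ ∈ ⋀[ℝ]^2 V)
    (hstar : ∀ ξ ∈ ⋀[ℝ]^2 V, ∀ η ∈ ⋀[ℝ]^2 V, ξ * star η = Bh ξ η • dV)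
    (a b c d f g : ℝ) :
    star (biv e a b c d f g) = biv e g (-f) d c (-b) a := by
  obtain ⟨a2, b2, c2, d2, f2, g2, h⟩ := exists_biv e (hstar_mem _ (biv_mem e a b c d f g))
  have key : ∀ p q r s t u : ℝ, p * g2 - q * f2 + r * d2 + s * c2 - t * b2 + u * a2 =
      p * a + q * b + r * c + s * d + t * f + u * g := by
    intro p q r s t u
    have := hstar _ (biv_mem e p q r s t u) _ (biv_mem e a b c d f g)
    rw [h, biv_mul, Bh_biv e Bh hBh, hdV] at this
    exact smul_left_injective ℝ (dV_ne e) this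
  have k1 := key 1 0 0 0 0 0
  have k2 := key 0 1 0 0 0 0
  have k3 := key 0 0 1 0 0 0
  have k4 := key 0 0 0 1 0 0
  have k5 := key 0 0 0 0 1 0
  have k6 := key 0 0 0 0 0 1
  rw [h]
  congr 1 <;> linarith

end HodgeAux

set_option maxHeartbeats 4000000

open HodgeAux in
/-- Let `V` be an oriented 4-dimensional real inner product space
(inner product `h`), with induced inner product `Bh` on `Λ²V`, unit orientation
form `dV` (the wedge of a positively oriented `h`-orthonormal basis), and Hodge
star `star` defined by `ξ ∧ star η = ⟨ξ,η⟩_h dV`.  Let `R̂_h : Λ²V → Λ²V` be a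
`Bh`-self-adjoint operator satisfying the first Bianchi identity with respect to
`Bh` (its associated 4-tensor `T(v,w,x,y) = ⟨R̂_h(v∧w), x∧y⟩_h` satisfies the
cyclic identity).  Then `R̂_h` commutes with `star` on `Λ²V` if and only if
`⟨R̂_h(star P), star P⟩_h = ⟨R̂_h P, P⟩_h` for every decomposable unit bivector
`P = v∧w` with `⟨P,P⟩_h = 1`. -/
theorem stmt_10 {V : Type*} [NormedAddCommGroup V] [InnerProductSpace ℝ V]
    [FiniteDimensional ℝ V] (hdim : Module.finrank ℝ V = 4)
    (Bh : ExteriorAlgebra ℝ V →ₗ[ℝ] ExteriorAlgebra ℝ V →ₗ[ℝ] ℝ)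
    (hBh : ∀ v w x y : V,
      Bh (ι ℝ v * ι ℝ w) (ι ℝ x * ι ℝ y) = ⟪v, x⟫ * ⟪w, y⟫ - ⟪v, y⟫ * ⟪w, x⟫)
    (e : OrthonormalBasis (Fin 4) ℝ V)
    (dV : ExteriorAlgebra ℝ V)
    (hdV : dV = ι ℝ (e 0) * ι ℝ (e 1) * ι ℝ (e 2) * ι ℝ (e 3))
    (star : ExteriorAlgebra ℝ V →ₗ[ℝ] ExteriorAlgebra ℝ V)
    (hstar_mem : ∀ ξ ∈ ⋀[ℝ]^2 V, star ξ ∈ ⋀[ℝ]^2 V)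
    (hstar : ∀ ξ ∈ ⋀[ℝ]^2 V, ∀ η ∈ ⋀[ℝ]^2 V, ξ * star η = Bh ξ η • dV)
    (Rh : ExteriorAlgebra ℝ V →ₗ[ℝ] ExteriorAlgebra ℝ V)
    (hRh_mem : ∀ ξ ∈ ⋀[ℝ]^2 V, Rh ξ ∈ ⋀[ℝ]^2 V)
    (hRh_sa : ∀ ξ ∈ ⋀[ℝ]^2 V, ∀ η ∈ ⋀[ℝ]^2 V, Bh (Rh ξ) η = Bh ξ (Rh η))
    (hRh_bianchi : ∀ v w x y : V,
      Bh (Rh (ι ℝ v * ι ℝ w)) (ι ℝ x * ι ℝ y)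
        + Bh (Rh (ι ℝ w * ι ℝ x)) (ι ℝ v * ι ℝ y)
        + Bh (Rh (ι ℝ x * ι ℝ v)) (ι ℝ w * ι ℝ y) = 0) :
    (∀ ξ ∈ ⋀[ℝ]^2 V, Rh (star ξ) = star (Rh ξ)) ↔
      (∀ v w : V, Bh (ι ℝ v * ι ℝ w) (ι ℝ v * ι ℝ w) = 1 →
        Bh (Rh (star (ι ℝ v * ι ℝ w))) (star (ι ℝ v * ι ℝ w))
          = Bh (Rh (ι ℝ v * ι ℝ w)) (ι ℝ v * ι ℝ w)) := by
  have hs := star_biv e Bh hBh dV hdV star hstar_mem hstar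
  have hB := Bh_biv e Bh hBh
  -- `star` is an involution
  have hss : ∀ ξ ∈ ⋀[ℝ]^2 V, star (star ξ) = ξ := by
    intro ξ hξ
    obtain ⟨a, b, c, d, f, g, rfl⟩ := exists_biv e hξ
    rw [hs, hs, neg_neg, neg_neg]
  -- `star` is self-adjoint
  have hsa : ∀ ξ ∈ ⋀[ℝ]^2 V, ∀ η ∈ ⋀[ℝ]^2 V, Bh (star ξ) η = Bh ξ (star η) := by
    intro ξ hξ η hη
    obtain ⟨a, b, c, d, f, g, rfl⟩ := exists_biv e hξ
    obtain ⟨a2, b2, c2, d2, f2, g2, rfl⟩ := exists_biv e hη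
    rw [hs, hs, hB, hB]
    ring
  have hsym : ∀ ξ ∈ ⋀[ℝ]^2 V, ∀ η ∈ ⋀[ℝ]^2 V, Bh ξ η = Bh η ξ := by
    intro ξ hξ η hη
    obtain ⟨a, b, c, d, f, g, rfl⟩ := exists_biv e hξ
    obtain ⟨a2, b2, c2, d2, f2, g2, rfl⟩ := exists_biv e hη
    rw [hB, hB]
    ring
  have hnd : ∀ ξ ∈ ⋀[ℝ]^2 V, ∀ η ∈ ⋀[ℝ]^2 V, (∀ ζ ∈ ⋀[ℝ]^2 V, Bh ξ ζ = Bh η ζ) → ξ = η := by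
    intro ξ hξ η hη h
    obtain ⟨a, b, c, d, f, g, rfl⟩ := exists_biv e hξ
    obtain ⟨a2, b2, c2, d2, f2, g2, rfl⟩ := exists_biv e hη
    have k1 := h _ (biv_mem e 1 0 0 0 0 0)
    have k2 := h _ (biv_mem e 0 1 0 0 0 0)
    have k3 := h _ (biv_mem e 0 0 1 0 0 0)
    have k4 := h _ (biv_mem e 0 0 0 1 0 0)
    have k5 := h _ (biv_mem e 0 0 0 0 1 0)
    have k6 := h _ (biv_mem e 0 0 0 0 0 1)
    rw [hB, hB] at k1 k2 k3 k4 k5 k6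
    congr 1 <;> linarith
  constructor
  · intro h v w _
    have hm := mul_mem v w
    rw [h _ hm, hsa _ (hRh_mem _ hm) _ (hstar_mem _ hm), hss _ hm]
  · intro h
    -- the hypothesis in coordinates
    have hq : ∀ x0 x1 x2 x3 y0 y1 y2 y3 : ℝ,
        (x0 * y1 - x1 * y0) ^ 2 + (x0 * y2 - x2 * y0) ^ 2 + (x0 * y3 - x3 * y0) ^ 2
          + (x1 * y2 - x2 * y1) ^ 2 + (x1 * y3 - x3 * y1) ^ 2 + (x2 * y3 - x3 * y2) ^ 2 = 1 →
        Bh (Rh (biv e (x2 * y3 - x3 * y2) (-(x1 * y3 - x3 * y1)) (x1 * y2 - x2 * y1)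
            (x0 * y3 - x3 * y0) (-(x0 * y2 - x2 * y0)) (x0 * y1 - x1 * y0)))
          (biv e (x2 * y3 - x3 * y2) (-(x1 * y3 - x3 * y1)) (x1 * y2 - x2 * y1)
            (x0 * y3 - x3 * y0) (-(x0 * y2 - x2 * y0)) (x0 * y1 - x1 * y0))
        = Bh (Rh (biv e (x0 * y1 - x1 * y0) (x0 * y2 - x2 * y0) (x0 * y3 - x3 * y0)
            (x1 * y2 - x2 * y1) (x1 * y3 - x3 * y1) (x2 * y3 - x3 * y2)))
          (biv e (x0 * y1 - x1 * y0) (x0 * y2 - x2 * y0) (x0 * y3 - x3 * y0)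
            (x1 * y2 - x2 * y1) (x1 * y3 - x3 * y1) (x2 * y3 - x3 * y2)) := by
      intro x0 x1 x2 x3 y0 y1 y2 y3 hx
      have := h (x0 • e 0 + x1 • e 1 + x2 • e 2 + x3 • e 3)
        (y0 • e 0 + y1 • e 1 + y2 • e 2 + y3 • e 3)
      rw [mul_eq_biv, hB, hs] at this
      exact this (by rw [← hx]; ring)
    -- `Rh` and `star` preserve the form
    have hmain : ∀ ξ ∈ ⋀[ℝ]^2 V, ∀ η ∈ ⋀[ℝ]^2 V,
        Bh (Rh (star ξ)) (star η) = Bh (Rh ξ) η := by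
      have hrs : ∀ v w x y : V, Bh (Rh (ι ℝ v * ι ℝ w)) (ι ℝ x * ι ℝ y) =
          Bh (Rh (ι ℝ x * ι ℝ y)) (ι ℝ v * ι ℝ w) := by
        intro v w x y
        rw [hRh_sa _ (mul_mem _ _) _ (mul_mem _ _),
          hsym _ (mul_mem _ _) _ (hRh_mem _ (mul_mem _ _))]
      obtain ⟨r00, r01, r02, r03, r04, r05, r11, r12, r13, r14, r15, r22, r23, r24, r25, r33, r34, r35, r44, r45, r55, hr⟩ : ∃ r00 r01 r02 r03 r04 r05 r11 r12 r13 r14 r15 r22 r23 r24 r25 r33 r34 r35 r44 r45 r55 : ℝ,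
          ∀ a b c d f g a2 b2 c2 d2 f2 g2 : ℝ,
          Bh (Rh (biv e a b c d f g)) (biv e a2 b2 c2 d2 f2 g2) =
            a * (r00 * a2 + r01 * b2 + r02 * c2 + r03 * d2 + r04 * f2 + r05 * g2)
            + b * (r01 * a2 + r11 * b2 + r12 * c2 + r13 * d2 + r14 * f2 + r15 * g2)
            + c * (r02 * a2 + r12 * b2 + r22 * c2 + r23 * d2 + r24 * f2 + r25 * g2)
            + d * (r03 * a2 + r13 * b2 + r23 * c2 + r33 * d2 + r34 * f2 + r35 * g2)
            + f * (r04 * a2 + r14 * b2 + r24 * c2 + r34 * d2 + r44 * f2 + r45 * g2)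
            + g * (r05 * a2 + r15 * b2 + r25 * c2 + r35 * d2 + r45 * f2 + r55 * g2) := by
        refine ⟨Bh (Rh (ι ℝ (e 0) * ι ℝ (e 1))) (ι ℝ (e 0) * ι ℝ (e 1)),
          Bh (Rh (ι ℝ (e 0) * ι ℝ (e 1))) (ι ℝ (e 0) * ι ℝ (e 2)),
          Bh (Rh (ι ℝ (e 0) * ι ℝ (e 1))) (ι ℝ (e 0) * ι ℝ (e 3)),
          Bh (Rh (ι ℝ (e 0) * ι ℝ (e 1))) (ι ℝ (e 1) * ι ℝ (e 2)),
          Bh (Rh (ι ℝ (e 0) * ι ℝ (e 1))) (ι ℝ (e 1) * ι ℝ (e 3)),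
          Bh (Rh (ι ℝ (e 0) * ι ℝ (e 1))) (ι ℝ (e 2) * ι ℝ (e 3)),
          Bh (Rh (ι ℝ (e 0) * ι ℝ (e 2))) (ι ℝ (e 0) * ι ℝ (e 2)),
          Bh (Rh (ι ℝ (e 0) * ι ℝ (e 2))) (ι ℝ (e 0) * ι ℝ (e 3)),
          Bh (Rh (ι ℝ (e 0) * ι ℝ (e 2))) (ι ℝ (e 1) * ι ℝ (e 2)),
          Bh (Rh (ι ℝ (e 0) * ι ℝ (e 2))) (ι ℝ (e 1) * ι ℝ (e 3)),
          Bh (Rh (ι ℝ (e 0) * ι ℝ (e 2))) (ι ℝ (e 2) * ι ℝ (e 3)),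
          Bh (Rh (ι ℝ (e 0) * ι ℝ (e 3))) (ι ℝ (e 0) * ι ℝ (e 3)),
          Bh (Rh (ι ℝ (e 0) * ι ℝ (e 3))) (ι ℝ (e 1) * ι ℝ (e 2)),
          Bh (Rh (ι ℝ (e 0) * ι ℝ (e 3))) (ι ℝ (e 1) * ι ℝ (e 3)),
          Bh (Rh (ι ℝ (e 0) * ι ℝ (e 3))) (ι ℝ (e 2) * ι ℝ (e 3)),
          Bh (Rh (ι ℝ (e 1) * ι ℝ (e 2))) (ι ℝ (e 1) * ι ℝ (e 2)),
          Bh (Rh (ι ℝ (e 1) * ι ℝ (e 2))) (ι ℝ (e 1) * ι ℝ (e 3)),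
          Bh (Rh (ι ℝ (e 1) * ι ℝ (e 2))) (ι ℝ (e 2) * ι ℝ (e 3)),
          Bh (Rh (ι ℝ (e 1) * ι ℝ (e 3))) (ι ℝ (e 1) * ι ℝ (e 3)),
          Bh (Rh (ι ℝ (e 1) * ι ℝ (e 3))) (ι ℝ (e 2) * ι ℝ (e 3)),
          Bh (Rh (ι ℝ (e 2) * ι ℝ (e 3))) (ι ℝ (e 2) * ι ℝ (e 3)), ?_⟩
        intro a b c d f g a2 b2 c2 d2 f2 g2
        simp only [biv, map_add, map_smul, LinearMap.add_apply, LinearMap.smul_apply, smul_eq_mul]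
        rw [hrs (e 0) (e 2) (e 0) (e 1),
          hrs (e 0) (e 3) (e 0) (e 1),
          hrs (e 0) (e 3) (e 0) (e 2),
          hrs (e 1) (e 2) (e 0) (e 1),
          hrs (e 1) (e 2) (e 0) (e 2),
          hrs (e 1) (e 2) (e 0) (e 3),
          hrs (e 1) (e 3) (e 0) (e 1),
          hrs (e 1) (e 3) (e 0) (e 2),
          hrs (e 1) (e 3) (e 0) (e 3),
          hrs (e 1) (e 3) (e 1) (e 2),
          hrs (e 2) (e 3) (e 0) (e 1),
          hrs (e 2) (e 3) (e 0) (e 2),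
          hrs (e 2) (e 3) (e 0) (e 3),
          hrs (e 2) (e 3) (e 1) (e 2),
          hrs (e 2) (e 3) (e 1) (e 3)]
        ring
      simp only [hr] at hq
      have D00 : r55 = r00 := by
        have := hq 1 0 0 0 0 1 0 0 (by norm_num)
        linarith
      have D11 : r44 = r11 := by
        have := hq 1 0 0 0 0 0 1 0 (by norm_num)
        linarith
      have D22 : r33 = r22 := by
        have := hq 1 0 0 0 0 0 0 1 (by norm_num)
        linarith
      have O01 : r45 = -r01 := by
        have := hq 1 0 0 0 0 (3/5) (4/5) 0 (by norm_num)
        linarith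
      have O02 : r35 = r02 := by
        have := hq 1 0 0 0 0 (3/5) 0 (4/5) (by norm_num)
        linarith
      have O03 : r25 = r03 := by
        have := hq 0 1 0 0 (3/5) 0 (4/5) 0 (by norm_num)
        linarith
      have O04 : r15 = -r04 := by
        have := hq 0 1 0 0 (3/5) 0 0 (4/5) (by norm_num)
        linarith
      have O12 : r34 = -r12 := by
        have := hq 1 0 0 0 0 0 (3/5) (4/5) (by norm_num)
        linarith
      have O13 : r24 = -r13 := by
        have := hq 0 0 1 0 (3/5) (4/5) 0 0 (by norm_num)
        linarith
      intro ξ hξ η hη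
      obtain ⟨a, b, c, d, f, g, rfl⟩ := exists_biv e hξ
      obtain ⟨a2, b2, c2, d2, f2, g2, rfl⟩ := exists_biv e hη
      rw [hs, hs, hr, hr, D00, D11, D22, O01, O02, O03, O04, O12, O13]
      ring
    intro ξ hξ
    refine hnd _ (hRh_mem _ (hstar_mem _ hξ)) _ (hstar_mem _ (hRh_mem _ hξ)) fun ζ hζ => ?_
    rw [hsa _ (hRh_mem _ hξ) _ hζ, ← hmain ξ hξ _ (hstar_mem _ hζ), hss _ hζ]
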